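/- Let G be a complete edge-colored permutation graph. Then for every strong prime module M of G with |M| ≥ 2 the quotient graph G[M]/P_max(M) is a complete edge-colored permutation graph; moreover, for every strong prime module M with |M| ≥ 3, exactly two distinct colors appear on the edges of the quotient graph G[M]/P_max(M). -/

import Mathlib

/-- The edge relation `E` on `V` together with the labeling `ℓ : V ≃ Fin n`
is the simple permutation graph of the permutation `π` of `{1,…,n}`:
`{u,v} ∈ E ⇔ ℓ(u) > ℓ(v) and π⁻¹(ℓ(u)) < π⁻¹(ℓ(v))` (stated symmetrically in `u,v`). -/
def IsPermGraph {V : Type*} {n : ℕ} (E : V → V → Prop) (ℓ : V ≃ Fin n)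
    (π : Equiv.Perm (Fin n)) : Prop :=
  ∀ u v : V, E u v ↔
    ((ℓ v < ℓ u ∧ π⁻¹ (ℓ u) < π⁻¹ (ℓ v)) ∨ (ℓ u < ℓ v ∧ π⁻¹ (ℓ v) < π⁻¹ (ℓ u)))

/-- `c` is the edge-coloring of a complete `k`-edge-colored graph on `V`:
it is symmetric, every pair of distinct vertices receives a color in `{1,…,k}`,
and every color in `{1,…,k}` occurs on some edge. -/
def IsCompleteColoring {V : Type*} (k : ℕ) (c : V → V → ℕ) : Prop :=
  (∀ u v : V, c u v = c v u) ∧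
  (∀ u v : V, u ≠ v → c u v ∈ Finset.Icc 1 k) ∧
  (∀ i ∈ Finset.Icc 1 k, ∃ u v : V, u ≠ v ∧ c u v = i)

/-- The edge relation of the `i`-th monochromatic subgraph `G_{|i}`. -/
def monoEdge {V : Type*} (c : V → V → ℕ) (i : ℕ) : V → V → Prop :=
  fun u v => u ≠ v ∧ c u v = i

/-- The complete edge-colored graph with coloring `c` is a complete edge-colored
permutation graph: there are a labeling `ℓ` and permutations `π i` such that every
monochromatic subgraph `(G_{|i}, ℓ)` is the simple permutation graph of `π i`. -/
def IsCECPG {V : Type*} [Fintype V] (c : V → V → ℕ) : Prop :=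
  ∃ (ℓ : V ≃ Fin (Fintype.card V)) (π : ℕ → Equiv.Perm (Fin (Fintype.card V))),
    ∀ i : ℕ, IsPermGraph (monoEdge c i) ℓ (π i)

/-- `c` contains a rainbow triangle: three vertices whose three connecting edges
have pairwise distinct colors. -/
def HasRainbowTriangle {V : Type*} (c : V → V → ℕ) : Prop :=
  ∃ u v w : V, u ≠ v ∧ u ≠ w ∧ v ≠ w ∧
    c u v ≠ c u w ∧ c u v ≠ c v w ∧ c u w ≠ c v w

/-- `M` is a module of the complete edge-colored graph with coloring `c`. -/
def IsModule {V : Type*} (c : V → V → ℕ) (M : Set V) : Prop :=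
  ∀ u ∈ M, ∀ w ∈ M, ∀ v ∉ M, c u v = c w v

/-- `M` is a strong module: a module that overlaps no other module. -/
def IsStrongModule {V : Type*} (c : V → V → ℕ) (M : Set V) : Prop :=
  IsModule c M ∧ ∀ M' : Set V, IsModule c M' → M ⊆ M' ∨ M' ⊆ M ∨ M ∩ M' = ∅

/-- `N` is a member of `P_max(M)`: a non-empty strong module that is a proper subset
of `M` and is inclusion-maximal among strong modules properly contained in `M`. -/
def PmaxPart {V : Type*} (c : V → V → ℕ) (M N : Set V) : Prop :=
  N.Nonempty ∧ IsStrongModule c N ∧ N ⊂ M ∧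
    ∀ N' : Set V, IsStrongModule c N' → N' ⊂ M → N ⊆ N' → N' = N

/-- The edge relation of the `i`-th monochromatic subgraph of the quotient graph
`G[M]/P_max(M)`: two distinct parts are adjacent with color `i` iff some (equivalently,
by the module property, every) edge between them has color `i`. -/
def quotientMonoEdge {V : Type*} (c : V → V → ℕ) (M : Set V) (i : ℕ) :
    {N : Set V // PmaxPart c M N} → {N : Set V // PmaxPart c M N} → Prop :=
  fun N₁ N₂ => N₁ ≠ N₂ ∧ ∃ u ∈ N₁.1, ∃ v ∈ N₂.1, c u v = i

/-- The quotient graph `G[M]/P_max(M)` is a complete edge-colored permutation graph. -/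
def QuotientIsCECPG {V : Type*} (c : V → V → ℕ) (M : Set V) : Prop :=
  ∃ (m : ℕ) (ℓ : {N : Set V // PmaxPart c M N} ≃ Fin m)
    (π : ℕ → Equiv.Perm (Fin m)),
    ∀ i : ℕ, IsPermGraph (quotientMonoEdge c M i) ℓ (π i)

/-- The strong module `M` (with `|M| ≥ 2`) is series: its quotient graph has at least
two vertices and all its edges carry the same color. -/
def IsSeriesModule {V : Type*} (c : V → V → ℕ) (M : Set V) : Prop :=
  (∃ N₁ N₂ : Set V, PmaxPart c M N₁ ∧ PmaxPart c M N₂ ∧ N₁ ≠ N₂) ∧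
  (∀ N₁ N₂ N₁' N₂' : Set V, PmaxPart c M N₁ → PmaxPart c M N₂ →
    PmaxPart c M N₁' → PmaxPart c M N₂' → N₁ ≠ N₂ → N₁' ≠ N₂' →
    ∀ u v u' v' : V, u ∈ N₁ → v ∈ N₂ → u' ∈ N₁' → v' ∈ N₂' → c u v = c u' v')

/-- The color `i` appears on some edge of the quotient graph `G[M]/P_max(M)`. -/
def QuotientColorAppears {V : Type*} (c : V → V → ℕ) (M : Set V) (i : ℕ) : Prop :=
  ∃ N₁ N₂ : Set V, PmaxPart c M N₁ ∧ PmaxPart c M N₂ ∧ N₁ ≠ N₂ ∧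
    ∃ u ∈ N₁, ∃ v ∈ N₂, c u v = i

/-- One step inside `S` along an edge whose color belongs to `p`. -/
def ColorStep {V : Type*} (c : V → V → ℕ) (S : Set V) (p : Set ℕ) (x y : V) : Prop :=
  x ∈ S ∧ y ∈ S ∧ x ≠ y ∧ c x y ∈ p

/-- `y` is joined to `x` by a path inside `S` whose edge colors all belong to `p`. -/
abbrev ColorReach {V : Type*} (c : V → V → ℕ) (S : Set V) (p : Set ℕ) : V → V → Prop :=
  Relation.ReflTransGen (ColorStep c S p)

section Reach

variable {V : Type*} {c : V → V → ℕ}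

theorem ColorReach.symm (hs : ∀ u v, c u v = c v u) {S : Set V} {p : Set ℕ} {x y : V}
    (h : ColorReach c S p x y) : ColorReach c S p y x := by
  have : Std.Symm (ColorStep c S p) :=
    ⟨fun a b ⟨ha, hb, hab, hp⟩ => ⟨hb, ha, hab.symm, hs a b ▸ hp⟩⟩
  exact Std.Symm.symm _ _ h

theorem ColorReach.mem {S : Set V} {p : Set ℕ} {x y : V} (hx : x ∈ S)
    (h : ColorReach c S p x y) : y ∈ S := by
  cases h with
  | refl => exact hx
  | tail _ h => exact h.2.1

theorem color_eq_of_reach (hr : ¬ HasRainbowTriangle c)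
    {S : Set V} {i : ℕ} {u w v : V} (hv : v ∈ S)
    (huw : ColorReach c S {i} u w) (huv : ¬ ColorReach c S {i} u v) : c u v = c w v := by
  induction huw with
  | refl => rfl
  | @tail a b hua hab ih =>
    rw [ih]
    obtain ⟨ha, hb, hne, hi⟩ := hab
    have hub : ColorReach c S {i} u b := hua.tail ⟨ha, hb, hne, hi⟩
    have hav : a ≠ v := by rintro rfl; exact huv hua
    have hbv : b ≠ v := by rintro rfl; exact huv hub
    have h1 : c a v ≠ i := fun h => huv (hua.tail ⟨ha, hv, hav, h⟩)
    have h2 : c b v ≠ i := fun h => huv (hub.tail ⟨hb, hv, hbv, h⟩)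
    simp only [Set.mem_singleton_iff] at hi
    by_contra h3
    exact hr ⟨a, b, v, hne, hav, hbv, by grind, by grind, h3⟩

/-- A path from `T` to the extra vertex `v` enters `v` from the component, inside `T`, of its
starting point. -/
theorem exists_reach_edge (hs : ∀ u v, c u v = c v u) {T : Set V} {v : V} {i : ℕ} {x : V}
    (hv : v ∉ T) (hx : x ∈ T) (h : ColorReach c (insert v T) {i} x v) :
    ∃ x' ∈ T, ColorReach c T {i} x x' ∧ c v x' = i := by
  induction h using Relation.ReflTransGen.head_induction_on with
  | refl => exact absurd hx hv
  | @head a b hab _ ih =>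
    obtain ⟨-, hb, hne, hi⟩ := hab
    rcases hb with rfl | hb
    · exact ⟨a, hx, .refl, (hs _ _).trans hi⟩
    · obtain ⟨x', hx', hr, hc⟩ := ih hb
      exact ⟨x', hx', hr.head ⟨hx, hb, hne, hi⟩, hc⟩

theorem not_all_connected_insert (hs : ∀ u v, c u v = c v u) (hr : ¬ HasRainbowTriangle c)
    {T : Set V} {v : V} {i j k : ℕ} (hij : i ≠ j) (hik : i ≠ k) (hjk : j ≠ k) (hv : v ∉ T)
    (hT : ∃ x ∈ T, ∃ y ∈ T, ¬ ColorReach c T {i} x y)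
    (hS : ∀ l ∈ ({i, j, k} : Set ℕ), ∀ x ∈ insert v T, ∀ y ∈ insert v T,
      ColorReach c (insert v T) {l} x y) : False := by
  obtain ⟨x, hx, y, hy, hxy⟩ := hT
  have hto : ∀ l ∈ ({i, j, k} : Set ℕ), ∀ z ∈ T, ∃ z' ∈ T, ColorReach c T {l} z z' ∧ c v z' = l :=
    fun l hl z hz => exists_reach_edge hs hv hz (hS l hl z (.inr hz) v (.inl rfl))
  have hi := hto i (by simp)
  obtain ⟨u, hu, -, hvu⟩ := hto j (by simp) x hx
  obtain ⟨w, hw, -, hvw⟩ := hto k (by simp) x hx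
  have key : ∀ l, l ≠ i → ∀ a ∈ T, c v a = l → ∀ b ∈ T, c v b = i →
      ¬ ColorReach c T {i} a b → c a b = l := by
    intro l hl a ha hva b hb hvb hab
    have hne : a ≠ b := by rintro rfl; exact hab .refl
    have h1 : c a b ≠ i := fun h => hab (.single ⟨ha, hb, hne, h⟩)
    by_contra h2
    exact hr ⟨v, a, b, by grind, by grind, hne, by grind, by grind, by grind⟩
  by_cases huw : ColorReach c T {i} u w
  · obtain ⟨z, hz, huz⟩ : ∃ z ∈ T, ¬ ColorReach c T {i} u z := by
      by_contra! hcon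
      exact hxy (((hcon x hx).symm hs).trans (hcon y hy))
    obtain ⟨z', hz', hzz', hvz'⟩ := hi z hz
    have huz' : ¬ ColorReach c T {i} u z' := fun h => huz (h.trans (hzz'.symm hs))
    have hwz' : ¬ ColorReach c T {i} w z' := fun h => huz' (huw.trans h)
    have h1 := key j hij.symm u hu hvu z' hz' hvz' huz'
    have h2 := key k hik.symm w hw hvw z' hz' hvz' hwz'
    have h3 := color_eq_of_reach hr hz' huw huz'
    exact hjk (by rw [← h1, h3, h2])
  · obtain ⟨u', hu', huu', hvu'⟩ := hi u hu
    obtain ⟨w', hw', hww', hvw'⟩ := hi w hw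
    have hwu : ¬ ColorReach c T {i} w u := fun h => huw (h.symm hs)
    have h1 := key j hij.symm u hu hvu w' hw' hvw' fun h => huw (h.trans (hww'.symm hs))
    have h2 := key k hik.symm w hw hvw u' hu' hvu' fun h => hwu (h.trans (huu'.symm hs))
    have h3 := color_eq_of_reach hr hw huu' huw
    have h4 := color_eq_of_reach hr hu hww' hwu
    have := hs u w
    have := hs u w'
    have := hs w u'
    grind

/-- Gallai's theorem: without rainbow triangles, at most two colors span connected graphs. -/
theorem exists_disconnected_color (hs : ∀ u v, c u v = c v u) (hr : ¬ HasRainbowTriangle c)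
    {i j k : ℕ} (hij : i ≠ j) (hik : i ≠ k) (hjk : j ≠ k) (S : Finset V)
    (hS : (S : Set V).Nontrivial) :
    ∃ l ∈ ({i, j, k} : Set ℕ), ∃ x ∈ S, ∃ y ∈ S, ¬ ColorReach c (S : Set V) {l} x y := by
  classical
  induction S using Finset.induction_on with
  | empty => simp at hS
  | @insert v T hv ih =>
    by_cases hT : (T : Set V).Nontrivial
    · obtain ⟨l, hl, hdis⟩ := ih hT
      by_contra! hcon
      have hcon' : ∀ l ∈ ({i, j, k} : Set ℕ), ∀ x ∈ insert v (T : Set V),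
          ∀ y ∈ insert v (T : Set V), ColorReach c (insert v (T : Set V)) {l} x y := by
        simpa using hcon
      have hv' : v ∉ (T : Set V) := by simpa using hv
      have hdis' : ∃ x ∈ (T : Set V), ∃ y ∈ (T : Set V), ¬ ColorReach c (T : Set V) {l} x y := by
        simpa using hdis
      rcases hl with rfl | rfl | rfl
      · exact not_all_connected_insert hs hr hij hik hjk hv' hdis' hcon'
      · exact not_all_connected_insert hs hr hij.symm hjk hik hv' hdis' fun m hm =>
          hcon' m (by grind)
      · exact not_all_connected_insert hs hr hik.symm hjk.symm hij hv' hdis' fun m hm =>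
          hcon' m (by grind)
    · rw [Set.not_nontrivial_iff] at hT
      obtain ⟨t, ht, htv⟩ := hS.exists_ne v
      have htT : t ∈ T := by grind
      obtain ⟨l, hl, hlc⟩ : ∃ l ∈ ({i, j, k} : Set ℕ), c v t ≠ l := by
        by_cases h : c v t = i
        · exact ⟨j, by simp, h ▸ hij⟩
        · exact ⟨i, by simp, h⟩
      refine ⟨l, hl, v, by simp, t, ht, fun h => ?_⟩
      rcases Relation.ReflTransGen.cases_head h with h | ⟨z, ⟨-, hz, hvz, hcz⟩, -⟩
      · exact htv h.symm
      · have hzT : z ∈ T := by grind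
        obtain rfl : z = t := hT hzT htT
        exact hlc hcz

end Reach

section Modules

variable {V : Type*} {c : V → V → ℕ}

theorem IsModule.union {A B : Set V} (hA : IsModule c A) (hB : IsModule c B)
    (hAB : (A ∩ B).Nonempty) : IsModule c (A ∪ B) := by
  obtain ⟨z, hzA, hzB⟩ := hAB
  have key : ∀ u ∈ A ∪ B, ∀ v ∉ A ∪ B, c u v = c z v := by
    rintro u (hu | hu) v hv
    · exact hA u hu z hzA v fun h => hv (.inl h)
    · exact hB u hu z hzB v fun h => hv (.inr h)
  exact fun u hu w hw v hv => (key u hu v hv).trans (key w hw v hv).symm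

/-- The components of a color inside a module are modules. -/
theorem isModule_component (hr : ¬ HasRainbowTriangle c)
    {M : Set V} (hM : IsModule c M) {i : ℕ} {x : V} (hx : x ∈ M) :
    IsModule c {y | ColorReach c M {i} x y} := by
  have key : ∀ u, ColorReach c M {i} x u → ∀ v, ¬ ColorReach c M {i} x v → c x v = c u v := by
    intro u hu v hv
    by_cases hvM : v ∈ M
    · exact color_eq_of_reach hr hvM hu hv
    · exact hM x hx u (hu.mem hx) v hvM
  exact fun u hu w hw v hv => (key u hu v hv).symm.trans (key w hw v hv)

/-- The components, inside a strong module, of the graph of all colors but `i` are strong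
modules. -/
theorem isStrongModule_component_compl (hs : ∀ u v, c u v = c v u)
    {M : Set V} (hM : IsStrongModule c M) {i : ℕ} {x : V} (hx : x ∈ M) :
    IsStrongModule c {y | ColorReach c M {i}ᶜ x y} := by
  have out : ∀ u, ColorReach c M {i}ᶜ x u → ∀ v ∈ M, ¬ ColorReach c M {i}ᶜ x v → c u v = i := by
    intro u hu v hv hxv
    by_contra h
    exact hxv (hu.tail ⟨hu.mem hx, hv, by rintro rfl; exact hxv hu, h⟩)
  refine ⟨fun u hu w hw v hv => ?_, fun W hW => ?_⟩
  · by_cases hvM : v ∈ M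
    · rw [out u hu v hvM hv, out w hw v hvM hv]
    · exact hM.1 u (ColorReach.mem hx hu) w (ColorReach.mem hx hw) v hvM
  by_contra! hcon
  obtain ⟨h1, h2, p, hp, hpW⟩ := hcon
  have hsub : {y | ColorReach c M {i}ᶜ x y} ⊆ M := fun y hy => ColorReach.mem hx hy
  obtain ⟨w, hwW, hw⟩ := Set.not_subset.1 h2
  have hWM : W ⊆ M := by
    rcases hM.2 W hW with h | h | h
    · exact absurd (hsub.trans h) h1
    · exact h
    · exact absurd h (Set.Nonempty.ne_empty ⟨p, hsub hp, hpW⟩)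
  refine h1 fun y hy => ?_
  have hpy : ColorReach c M {i}ᶜ p y := (ColorReach.symm hs hp).trans hy
  clear hy
  induction hpy with
  | refl => exact hpW
  | @tail a b hpa hab ih =>
    by_contra hb
    have hxb : ColorReach c M {i}ᶜ x b := (Relation.ReflTransGen.trans hp hpa).tail hab
    exact hab.2.2.2 ((hW a ih w hwW b hb).trans ((hs _ _).trans (out b hxb w (hWM hwW) hw)))

theorem isStrongModule_singleton (x : V) : IsStrongModule c {x} := by
  refine ⟨fun u hu w hw v _ => by rw [hu, hw], fun W _ => ?_⟩
  by_cases hx : x ∈ W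
  · exact .inl (by simpa using hx)
  · exact .inr (.inr (by simpa using hx))

theorem PmaxPart.eq_of_mem {M N₁ N₂ : Set V} (h₁ : PmaxPart c M N₁) (h₂ : PmaxPart c M N₂)
    {x : V} (hx₁ : x ∈ N₁) (hx₂ : x ∈ N₂) : N₁ = N₂ := by
  rcases h₁.2.1.2 N₂ h₂.2.1.1 with h | h | h
  · exact (h₁.2.2.2 N₂ h₂.2.1 h₂.2.2.1 h).symm
  · exact h₂.2.2.2 N₁ h₁.2.1 h₁.2.2.1 h
  · exact absurd h (Set.Nonempty.ne_empty ⟨x, hx₁, hx₂⟩)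

theorem PmaxPart.color_eq (hs : ∀ u v, c u v = c v u) {M N₁ N₂ : Set V}
    (h₁ : PmaxPart c M N₁) (h₂ : PmaxPart c M N₂) (hne : N₁ ≠ N₂) {u u' v v' : V}
    (hu : u ∈ N₁) (hu' : u' ∈ N₁) (hv : v ∈ N₂) (hv' : v' ∈ N₂) : c u v = c u' v' := by
  rw [h₁.2.1.1 u hu u' hu' v fun h => hne (h₁.eq_of_mem h₂ h hv), hs u' v, hs u' v']
  exact h₂.2.1.1 v hv v' hv' u' fun h => hne (h₁.eq_of_mem h₂ hu' h)

variable [Finite V]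

theorem exists_pmaxPart_superset {M D : Set V} (hD : IsStrongModule c D) (hne : D.Nonempty)
    (hDM : D ⊂ M) : ∃ N, PmaxPart c M N ∧ D ⊆ N := by
  obtain ⟨N, hDN, hN⟩ := (Set.toFinite {N : Set V | IsStrongModule c N ∧ N ⊂ M}).exists_le_maximal
    (⟨hD, hDM⟩ : D ∈ {N : Set V | IsStrongModule c N ∧ N ⊂ M})
  exact ⟨N, ⟨hne.mono hDN, hN.prop.1, hN.prop.2,
    fun N' h1 h2 h3 => (hN.eq_of_le ⟨h1, h2⟩ h3).symm⟩, hDN⟩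

theorem exists_pmaxPart_mem {M : Set V} (hM : M.Nontrivial) {x : V} (hx : x ∈ M) :
    ∃ N, PmaxPart c M N ∧ x ∈ N := by
  obtain ⟨y, hy, hyx⟩ := hM.exists_ne x
  obtain ⟨N, hN, hxN⟩ := exists_pmaxPart_superset (c := c) (isStrongModule_singleton x)
    (Set.singleton_nonempty x)
    ⟨by simpa using hx, fun h => hyx (h hy)⟩
  exact ⟨N, hN, hxN rfl⟩

theorem exists_pmaxPart_ne {M : Set V} (hM : M.Nontrivial) :
    ∃ N₁ N₂ : Set V, PmaxPart c M N₁ ∧ PmaxPart c M N₂ ∧ N₁ ≠ N₂ := by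
  obtain ⟨x, hx⟩ := hM.nonempty
  obtain ⟨N₁, h₁, -⟩ := exists_pmaxPart_mem (c := c) hM hx
  obtain ⟨y, hy, hyN⟩ := Set.exists_of_ssubset h₁.2.2.1
  obtain ⟨N₂, h₂, hy₂⟩ := exists_pmaxPart_mem (c := c) hM hy
  exact ⟨N₁, N₂, h₁, h₂, by rintro rfl; exact hyN hy₂⟩

/-- A strong module that splits into two nonempty sets joined by a single color is series. -/
theorem isSeriesModule_of_cut (hs : ∀ u v, c u v = c v u) {M A : Set V}
    (hM : IsStrongModule c M) (hnt : M.Nontrivial) {i : ℕ} (hA : A ⊆ M) (hAne : A.Nonempty)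
    (hB : (M \ A).Nonempty) (hcut : ∀ u ∈ A, ∀ v ∈ M \ A, c u v = i) : IsSeriesModule c M := by
  have hstay : ∀ x y, ColorReach c M {i}ᶜ x y → (x ∈ A ↔ y ∈ A) := by
    intro x y h
    induction h with
    | refl => rfl
    | @tail a b _ hab ih =>
      obtain ⟨ha, hb, -, hc⟩ := hab
      rw [ih]
      by_contra h
      have := hcut a
      have := hcut b
      have := hs a b
      simp only [Set.mem_compl_iff, Set.mem_singleton_iff] at hc
      grind
  have hout : ∀ N₁ N₂, PmaxPart c M N₁ → PmaxPart c M N₂ → N₁ ≠ N₂ →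
      ∀ u ∈ N₁, ∀ v ∈ N₂, c u v = i := by
    intro N₁ N₂ h₁ h₂ hne u hu v hv
    by_contra hc
    have huM := h₁.2.2.1.subset hu
    have hvM := h₂.2.2.1.subset hv
    have huv : ColorReach c M {i}ᶜ u v :=
      .single ⟨huM, hvM, by rintro rfl; exact hne (h₁.eq_of_mem h₂ hu hv), hc⟩
    obtain ⟨N, hN, hDN⟩ := exists_pmaxPart_superset (M := M)
      (isStrongModule_component_compl hs hM (i := i) huM) ⟨u, .refl⟩ (by
        refine ⟨fun y hy => ColorReach.mem huM hy, fun h => ?_⟩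
        obtain ⟨a, ha⟩ := hAne
        obtain ⟨b, hb, hbA⟩ := hB
        have h1 := hstay u a (h (hA ha))
        have h2 := hstay u b (h hb)
        tauto)
    exact hne ((h₁.eq_of_mem hN hu (hDN .refl)).trans (hN.eq_of_mem h₂ (hDN huv) hv))
  exact ⟨exists_pmaxPart_ne hnt, fun N₁ N₂ N₁' N₂' h₁ h₂ h₁' h₂' hne hne' u v u' v' hu hv hu' hv' =>
    (hout _ _ h₁ h₂ hne u hu v hv).trans (hout _ _ h₁' h₂' hne' u' hu' v' hv').symm⟩

/-- In a strong prime module, every proper submodule lies in a single part. -/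
theorem exists_pmaxPart_superset_of_isModule (hs : ∀ u v, c u v = c v u) {M C : Set V}
    (hM : IsStrongModule c M) (hnt : M.Nontrivial) (hser : ¬ IsSeriesModule c M)
    (hC : IsModule c C) (hne : C.Nonempty) (hCM : C ⊂ M) : ∃ N, PmaxPart c M N ∧ C ⊆ N := by
  obtain ⟨U, hCU, hU⟩ := (Set.toFinite {N : Set V | IsModule c N ∧ N ⊂ M}).exists_le_maximal
    (⟨hC, hCM⟩ : C ∈ {N : Set V | IsModule c N ∧ N ⊂ M})
  obtain ⟨hUm, hUM⟩ := hU.prop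
  by_cases hUs : IsStrongModule c U
  · obtain ⟨N, hN, hUN⟩ := exists_pmaxPart_superset hUs (hne.mono hCU) hUM
    exact ⟨N, hN, Set.Subset.trans hCU hUN⟩
  exfalso
  obtain ⟨W, hW, hUW, hWU, p, hpU, hpW⟩ : ∃ W, IsModule c W ∧ ¬ U ⊆ W ∧ ¬ W ⊆ U ∧
      (U ∩ W).Nonempty := by
    by_contra! hcon
    refine hUs ⟨hUm, fun W hW => ?_⟩
    by_contra! h
    exact h.2.2.ne_empty (hcon W hW h.1 h.2.1)
  have hWM : W ⊆ M := by
    rcases hM.2 W hW with h | h | h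
    · exact absurd (hUM.subset.trans h) hUW
    · exact h
    · exact absurd h (Set.Nonempty.ne_empty ⟨p, hUM.subset hpU, hpW⟩)
  have hun : U ∪ W = M := by
    by_contra h
    exact hWU (Set.subset_union_right.trans (hU.le_of_ge
      ⟨hUm.union hW ⟨p, hpU, hpW⟩, (Set.union_subset hUM.subset hWM).ssubset_of_ne h⟩
      Set.subset_union_left))
  obtain ⟨a, haU, haW⟩ := Set.not_subset.1 hUW
  obtain ⟨b, hbW, hbU⟩ := Set.not_subset.1 hWU
  refine hser (isSeriesModule_of_cut hs hM hnt (A := U) (i := c a b) hUM.subset ⟨a, haU⟩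
    ⟨b, hWM hbW, hbU⟩ fun u hu v hv => ?_)
  have hvW : v ∈ W := by
    rcases hun.symm.subset hv.1 with h | h
    · exact absurd h hv.2
    · exact h
  rw [hUm u hu a haU v hv.2, hs a v, hs a b]
  exact hW v hvW b hbW a haW

/-- At most two colors appear on the quotient of a strong prime module. -/
theorem quotientColor_not_three (hs : ∀ u v, c u v = c v u) (hr : ¬ HasRainbowTriangle c)
    {M : Set V} (hM : IsStrongModule c M) (hnt : M.Nontrivial) (hser : ¬ IsSeriesModule c M)
    {i j k : ℕ} (hij : i ≠ j) (hik : i ≠ k) (hjk : j ≠ k)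
    (hall : ∀ l ∈ ({i, j, k} : Set ℕ), QuotientColorAppears c M l) : False := by
  have hfin := M.toFinite
  obtain ⟨l, hl, x, hx, y, hy, hxy⟩ := exists_disconnected_color hs hr hij hik hjk hfin.toFinset
    (by simpa using hnt)
  simp only [Set.Finite.coe_toFinset, Set.Finite.mem_toFinset] at hx hy hxy
  obtain ⟨N₁, N₂, h₁, h₂, hne, u, hu, v, hv, huv⟩ := hall l hl
  have huM := h₁.2.2.1.subset hu
  have hvM := h₂.2.2.1.subset hv
  obtain ⟨N, hN, hCN⟩ := exists_pmaxPart_superset_of_isModule hs hM hnt hser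
    (isModule_component hr hM.1 (i := l) huM) ⟨u, .refl⟩
    ⟨fun z hz => ColorReach.mem huM hz, fun h =>
      hxy ((ColorReach.symm hs (h hx)).trans (h hy))⟩
  have huv' : ColorReach c M {l} u v :=
    .single ⟨huM, hvM, by rintro rfl; exact hne (h₁.eq_of_mem h₂ hu hv), huv⟩
  exact hne ((h₁.eq_of_mem hN hu (hCN .refl)).trans (hN.eq_of_mem h₂ (hCN huv') hv))

end Modules

theorem IsCECPG.not_hasRainbowTriangle {V : Type*} [Fintype V] {c : V → V → ℕ}
    (hs : ∀ u v, c u v = c v u) (h : IsCECPG c) : ¬ HasRainbowTriangle c := by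
  obtain ⟨ℓ, π, h⟩ := h
  have key : ∀ u v w, ℓ u < ℓ v → ℓ v < ℓ w → c u w = c u v ∨ c u w = c v w := by
    intro u v w huv hvw
    have h1 := (h (c u w) u w).1 ⟨by rintro rfl; exact absurd hvw huv.asymm, rfl⟩
    have h2 := (h (c u w) u v).2
    have h3 := (h (c u w) v w).2
    simp only [monoEdge] at h2 h3
    have : (π (c u w))⁻¹ (ℓ w) < (π (c u w))⁻¹ (ℓ u) := by
      rcases h1 with h1 | h1
      · exact absurd (huv.trans hvw) h1.1.asymm
      · exact h1.2
    by_cases hlt : (π (c u w))⁻¹ (ℓ v) < (π (c u w))⁻¹ (ℓ u)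
    · exact .inl (h2 (.inr ⟨huv, hlt⟩)).2.symm
    · exact .inr (h3 (.inr ⟨hvw, this.trans_le (not_lt.1 hlt)⟩)).2.symm
  rintro ⟨u, v, w, huv, huw, hvw, h1, h2, h3⟩
  have e1 := hs u v
  have e2 := hs u w
  have e3 := hs v w
  rcases lt_or_gt_of_ne (ℓ.injective.ne huv) with a | a <;>
  rcases lt_or_gt_of_ne (ℓ.injective.ne huw) with b | b <;>
  rcases lt_or_gt_of_ne (ℓ.injective.ne hvw) with d | d <;>
  grind

/-- Two injective rankings realize their inversions as a permutation graph, with a labeling that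
depends on the first ranking only. -/
theorem exists_isPermGraph_of_rankings {P ι α : Type*} [Finite P] [LinearOrder α]
    (f : P → α) (hf : f.Injective) (g : ι → P → α) (hg : ∀ i, (g i).Injective) :
    ∃ (m : ℕ) (ℓ : P ≃ Fin m) (π : ι → Equiv.Perm (Fin m)), ∀ i, IsPermGraph
      (fun x y => (f y < f x ∧ g i x < g i y) ∨ (f x < f y ∧ g i y < g i x)) ℓ (π i) := by
  classical
  have := Fintype.ofFinite P
  have rank : ∀ r : P → α, r.Injective →
      ∃ e : P ≃ Fin (Fintype.card P), ∀ x y, e x < e y ↔ r x < r y := by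
    intro r hr
    let := LinearOrder.lift' r hr
    exact ⟨(Fintype.orderIsoFinOfCardEq P rfl).symm.toEquiv,
      fun x y => (Fintype.orderIsoFinOfCardEq P rfl).symm.lt_iff_lt⟩
  obtain ⟨ℓ, hℓ⟩ := rank f hf
  choose e he using fun i => rank (g i) (hg i)
  refine ⟨_, ℓ, fun i => (e i).symm.trans ℓ, fun i x y => ?_⟩
  have hinv : ∀ z, ((e i).symm.trans ℓ)⁻¹ (ℓ z) = e i z := fun z => by
    simp [Equiv.Perm.inv_def]
  simp only [hinv, hℓ, he]

theorem quotientIsCECPG_of_isCECPG {V : Type*} [Fintype V] {c : V → V → ℕ}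
    (hs : ∀ u v, c u v = c v u) (h : IsCECPG c) (M : Set V) : QuotientIsCECPG c M := by
  obtain ⟨ℓ, π, h⟩ := h
  choose rep hrep using fun N : {N : Set V // PmaxPart c M N} => N.2.1
  have hinj : rep.Injective := fun N₁ N₂ heq =>
    Subtype.ext (N₁.2.eq_of_mem N₂.2 (hrep N₁) (heq ▸ hrep N₂))
  obtain ⟨m, ℓ', π', h'⟩ := exists_isPermGraph_of_rankings (fun N => ℓ (rep N))
    (ℓ.injective.comp hinj) (fun i N => (π i)⁻¹ (ℓ (rep N)))
    (fun i => (π i)⁻¹.injective.comp (ℓ.injective.comp hinj))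
  refine ⟨m, ℓ', π', fun i N₁ N₂ => ?_⟩
  refine Iff.trans ?_ ((h i (rep N₁) (rep N₂)).trans (h' i N₁ N₂))
  constructor
  · rintro ⟨hne, u, hu, v, hv, rfl⟩
    exact ⟨hinj.ne hne, N₁.2.color_eq hs N₂.2 (Subtype.coe_injective.ne hne)
      (hrep N₁) hu (hrep N₂) hv⟩
  · rintro ⟨hne, hc⟩
    exact ⟨fun heq => hne (congrArg rep heq), _, hrep N₁, _, hrep N₂, hc⟩

/-- If `G` is a complete edge-colored permutation graph, then for every
strong prime module `M` with `|M| ≥ 2` the quotient graph `G[M]/P_max(M)` is a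
complete edge-colored permutation graph; moreover, for every strong prime module `M`
with `|M| ≥ 3` exactly two distinct colors appear on the edges of `G[M]/P_max(M)`. -/
theorem stmt15 {V : Type*} [Fintype V] [Nonempty V] (k : ℕ) (c : V → V → ℕ)
    (hc : IsCompleteColoring k c) (h : IsCECPG c) :
    (∀ M : Set V, IsStrongModule c M → 2 ≤ M.ncard → ¬ IsSeriesModule c M →
      QuotientIsCECPG c M) ∧
    (∀ M : Set V, IsStrongModule c M → 3 ≤ M.ncard → ¬ IsSeriesModule c M →
      ∃ i j : ℕ, i ≠ j ∧ QuotientColorAppears c M i ∧ QuotientColorAppears c M j ∧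
        ∀ i' : ℕ, QuotientColorAppears c M i' → i' = i ∨ i' = j) := by
  have hs := hc.1
  have hr := h.not_hasRainbowTriangle hs
  refine ⟨fun M _ _ _ => quotientIsCECPG_of_isCECPG hs h M, fun M hM hcard hser => ?_⟩
  have hnt : M.Nontrivial := Set.one_lt_ncard_iff_nontrivial.1 (by omega)
  have hsome : ¬ ∀ i j, QuotientColorAppears c M i → QuotientColorAppears c M j → i = j :=
    fun hall => hser ⟨exists_pmaxPart_ne hnt,
      fun N₁ N₂ N₁' N₂' h₁ h₂ h₁' h₂' hne hne' u v u' v' hu hv hu' hv' =>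
        hall _ _ ⟨N₁, N₂, h₁, h₂, hne, u, hu, v, hv, rfl⟩
          ⟨N₁', N₂', h₁', h₂', hne', u', hu', v', hv', rfl⟩⟩
  push Not at hsome
  obtain ⟨i, j, hi, hj, hij⟩ := hsome
  refine ⟨i, j, hij, hi, hj, fun k hk => ?_⟩
  by_contra! hcon
  refine quotientColor_not_three hs hr hM hnt hser hij hcon.1.symm hcon.2.symm fun l hl => ?_
  rcases hl with rfl | rfl | rfl <;> assumption
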